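/- arXiv:2306.06519 — 10 statements merged into one kernel-verified Lean document; each statement's English description precedes it below -/
import Mathlib

section
/- Let G be a finite directed acyclic graph with exactly one vertex ρ of in-degree 0 (the root), in which every vertex of out-degree 0 (leaf) has in-degree 1, and in which the map sending each vertex of positive out-degree to its set of out-neighbours is injective (G is labellable). Let C be the cover of G, i.e. the (finite) set of out-neighbour sets of the vertices of positive out-degree, viewed as a collection of nonempty sets of non-root vertices. Then the following are equivalent: (a) G is tree-based, i.e. there is a function t assigning to each non-root vertex v one of its in-neighbours t(v) such that every vertex of positive out-degree equals t(w) for some vertex w (equivalently, keeping only the edges (t(v), v) yields a spanning tree of G rooted at ρ whose leaves are exactly the leaves of G); (b) there exist a partition π of the set of non-root vertices of G and a bijection φ from the blocks of π to the members of C such that B ⊆ φ(B) for every block B. -/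
/-- Let `G` be a finite DAG (edge relation `E`) with exactly one vertex `ρ`
of in-degree 0, in which every vertex of out-degree 0 has in-degree 1, and which is
labellable (vertices of positive out-degree have distinct out-neighbour sets).  Let `C` be
the cover of `G` (the set of out-neighbour sets of vertices of positive out-degree).  Then
`G` is tree-based (there is a choice `t` of an in-neighbour for each non-root vertex such
that every vertex of positive out-degree is chosen by some vertex) if and only if there are
a partition `π` of the non-root vertices and a bijection `φ` from the blocks of `π` to the
members of `C` with `B ⊆ φ B` for every block `B`. -/
theorem treeBased_iff_fully_embedded_partition
    {V : Type*} [Finite V] (E : V → V → Prop) (ρ : V)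
    (hacyclic : ∀ v, ¬ Relation.TransGen E v v)
    (hroot : ∀ u, ¬ E u ρ)
    (hroot_unique : ∀ v, (∀ u, ¬ E u v) → v = ρ)
    (hleaf : ∀ v, (∀ w, ¬ E v w) → ∃! u, E u v)
    (hlab : ∀ u v, (∃ w, E u w) → (∃ w, E v w) →
      {w | E u w} = {w | E v w} → u = v) :
    (∃ t : V → V,
        (∀ v, v ≠ ρ → E (t v) v) ∧
        (∀ u, (∃ w, E u w) → ∃ v, v ≠ ρ ∧ t v = u)) ↔
    (∃ (π : Set (Set V)) (φ : Set V → Set V),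
        (∀ B ∈ π, B.Nonempty) ∧
        π.Pairwise (Disjoint · ·) ∧
        ⋃₀ π = {v | v ≠ ρ} ∧
        Set.BijOn φ π {S | ∃ v, (∃ w, E v w) ∧ S = {w | E v w}} ∧
        (∀ B ∈ π, B ⊆ φ B)) := by
  constructor
  · rintro ⟨t, h1, h2⟩
    have key : ∀ u, (∃ w, E u w) →
        {w | ∃ v ∈ {v | v ≠ ρ ∧ t v = u}, E (t v) w} = {w | E u w} := by
      intro u hu
      obtain ⟨v, hv, hvu⟩ := h2 u hu
      ext w
      constructor
      · rintro ⟨v', ⟨_, rfl⟩, h⟩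
        exact h
      · intro h
        exact ⟨v, ⟨hv, hvu⟩, by rw [hvu]; exact h⟩
    refine ⟨{B | ∃ u, (∃ w, E u w) ∧ B = {v | v ≠ ρ ∧ t v = u}},
      fun B => {w | ∃ v ∈ B, E (t v) w}, ?_, ?_, ?_, ⟨?_, ?_, ?_⟩, ?_⟩
    · rintro B ⟨u, hu, rfl⟩
      exact h2 u hu
    · rintro B ⟨u, hu, rfl⟩ B' ⟨u', hu', rfl⟩ hne
      refine Set.disjoint_left.2 ?_
      rintro v ⟨_, hv⟩ ⟨_, hv'⟩
      apply hne
      rw [← hv, ← hv']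
    · ext v
      constructor
      · rintro ⟨B, ⟨u, hu, rfl⟩, hv⟩
        exact hv.1
      · intro hv
        exact ⟨_, ⟨t v, ⟨v, h1 v hv⟩, rfl⟩, hv, rfl⟩
    · rintro B ⟨u, hu, rfl⟩
      exact ⟨u, hu, key u hu⟩
    · rintro B ⟨u, hu, rfl⟩ B' ⟨u', hu', rfl⟩ h
      have h' := (key u hu).symm.trans (h.trans (key u' hu'))
      rw [hlab u u' hu hu' h']
    · rintro S ⟨u, hu, rfl⟩
      exact ⟨_, ⟨u, hu, rfl⟩, key u hu⟩
    · rintro B ⟨u, hu, rfl⟩ v hv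
      exact ⟨v, hv, h1 v hv.1⟩
  · rintro ⟨π, φ, hne, hdis, hun, ⟨hmaps, _, hsurj⟩, hsub⟩
    have ex : ∀ v, ∃ u, v ≠ ρ → (E u v ∧ ∃ B ∈ π, v ∈ B ∧ φ B = {w | E u w}) := by
      intro v
      by_cases hv : v = ρ
      · exact ⟨v, fun h => absurd hv h⟩
      · have hm : v ∈ ⋃₀ π := by rw [hun]; exact hv
        obtain ⟨B, hB, hvB⟩ := hm
        obtain ⟨u, _, hu⟩ := hmaps hB
        refine ⟨u, fun _ => ⟨?_, B, hB, hvB, hu⟩⟩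
        have := hsub B hB hvB
        rw [hu] at this
        exact this
    choose t ht using ex
    refine ⟨t, fun v hv => (ht v hv).1, ?_⟩
    intro u hu
    obtain ⟨B, hB, hBu⟩ := hsurj ⟨u, hu, rfl⟩
    obtain ⟨v, hv⟩ := hne B hB
    have hvρ : v ≠ ρ := by
      have : v ∈ ⋃₀ π := ⟨B, hB, hv⟩
      rw [hun] at this
      exact this
    obtain ⟨hE, B', hB', hvB', hφ⟩ := ht v hvρ
    have hBB : B' = B := by
      by_contra hne'
      exact Set.disjoint_left.1 (hdis hB' hB hne') hvB' hv
    refine ⟨v, hvρ, hlab _ _ ⟨v, hE⟩ hu ?_⟩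
    rw [← hφ, hBB, hBu]
end

section
/- Let t ≥ 1 and let a_0, a_1, …, a_{t+1} be distinct elements of a finite set, and let F be the fence cover consisting of the t + 1 two-element sets {a_0, a_1}, {a_1, a_2}, …, {a_t, a_{t+1}} of the set X = {a_0, …, a_{t+1}}. Then a partition π of X admits a bijection φ from its blocks to F with B ⊆ φ(B) for every block B if and only if, for some j with 0 ≤ j ≤ t, the blocks of π are exactly the two-element set {a_j, a_{j+1}} together with the singletons {a_i} for all i ∉ {j, j+1}. In particular, exactly t + 1 partitions of X fully embed in F. -/
namespace FenceAux

variable {α : Type*} [DecidableEq α] {t : ℕ}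

def edge (a : Fin (t + 2) → α) (i : Fin (t + 1)) : Finset α := {a i.castSucc, a i.succ}

def part (a : Fin (t + 2) → α) (j : Fin (t + 1)) : Finset (Finset α) :=
  insert ({a j.castSucc, a j.succ} : Finset α)
            ((Finset.univ.filter
                (fun i : Fin (t + 2) => i ≠ j.castSucc ∧ i ≠ j.succ)).image
              (fun i => ({a i} : Finset α)))

def psi (a : Fin (t + 2) → α) (j k : Fin (t + 1)) : Finset α :=
  if k < j then {a k.castSucc} else if k = j then edge a j else {a k.succ}

lemma mem_part (a : Fin (t + 2) → α) (j : Fin (t + 1)) (B : Finset α) :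
    B ∈ part a j ↔ B = edge a j ∨ ∃ i, i ≠ j.castSucc ∧ i ≠ j.succ ∧ B = {a i} := by
  simp only [part, edge, Finset.mem_insert, Finset.mem_image, Finset.mem_filter,
    Finset.mem_univ, true_and]
  constructor
  · rintro (h | ⟨i, ⟨h1, h2⟩, h3⟩)
    · exact Or.inl h
    · exact Or.inr ⟨i, h1, h2, h3.symm⟩
  · rintro (h | ⟨i, h1, h2, h3⟩)
    · exact Or.inl h
    · exact Or.inr ⟨i, ⟨h1, h2⟩, h3.symm⟩

lemma mem_edge (a : Fin (t + 2) → α) (ha : Function.Injective a) (j : Fin (t + 1)) (i) :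
    a i ∈ edge a j ↔ i = j.castSucc ∨ i = j.succ := by
  simp [edge, ha.eq_iff]

lemma edge_card (a : Fin (t + 2) → α) (ha : Function.Injective a) (j : Fin (t + 1)) :
    (edge a j).card = 2 := by
  apply Finset.card_pair
  intro h
  have := congrArg Fin.val (ha h)
  simp at this

lemma edge_inj (a : Fin (t + 2) → α) (ha : Function.Injective a) :
    Function.Injective (edge a) := by
  intro k l h
  have h1 : a k.castSucc ∈ edge a l := by rw [← h, mem_edge a ha]; simp
  have h2 : a k.succ ∈ edge a l := by rw [← h, mem_edge a ha]; simp
  rw [mem_edge a ha] at h1 h2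
  simp only [Fin.ext_iff, Fin.val_castSucc, Fin.val_succ] at *
  omega

lemma edge_ne (a : Fin (t + 2) → α) (ha : Function.Injective a) (j : Fin (t + 1)) (x : α) :
    edge a j ≠ {x} := by
  intro h
  have := edge_card a ha j
  rw [h] at this
  simp at this

lemma part_inj (a : Fin (t + 2) → α) (ha : Function.Injective a) :
    Function.Injective (part a) := by
  intro k l h
  have h1 : edge a k ∈ part a l := by rw [← h, mem_part]; simp
  rw [mem_part] at h1
  rcases h1 with h1 | ⟨i, _, _, h1⟩
  · exact edge_inj a ha h1
  · exact absurd h1 (edge_ne a ha _ _)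

lemma part_nonempty (a : Fin (t + 2) → α) (j) : ∀ B ∈ part a j, B.Nonempty := by
  intro B hB
  rw [mem_part] at hB
  rcases hB with rfl | ⟨i, _, _, rfl⟩
  · exact ⟨a j.castSucc, by simp [edge]⟩
  · simp

lemma part_disj (a : Fin (t + 2) → α) (ha : Function.Injective a) (j) :
    ∀ B ∈ part a j, ∀ B' ∈ part a j, B ≠ B' → Disjoint B B' := by
  intro B hB B' hB' hne
  rw [mem_part] at hB hB'
  rcases hB with rfl | ⟨i, h1, h2, rfl⟩ <;> rcases hB' with rfl | ⟨i', h1', h2', rfl⟩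
  · exact absurd rfl hne
  · rw [Finset.disjoint_singleton_right, mem_edge a ha]; tauto
  · rw [Finset.disjoint_singleton_left, mem_edge a ha]; tauto
  · simpa using fun h => hne (by rw [h])

lemma part_sup (a : Fin (t + 2) → α) (j) :
    (part a j).sup id = Finset.univ.image a := by
  ext x
  simp only [Finset.mem_sup, id, mem_part, Finset.mem_image, Finset.mem_univ, true_and]
  constructor
  · rintro ⟨B, rfl | ⟨i, _, _, rfl⟩, hx⟩
    · simp only [edge, Finset.mem_insert, Finset.mem_singleton] at hx
      rcases hx with rfl | rfl <;> simp
    · simp only [Finset.mem_singleton] at hx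
      exact ⟨i, hx.symm⟩
  · rintro ⟨i, rfl⟩
    by_cases h1 : i = j.castSucc
    · exact ⟨_, Or.inl rfl, by simp [edge, h1]⟩
    by_cases h2 : i = j.succ
    · exact ⟨_, Or.inl rfl, by simp [edge, h2]⟩
    exact ⟨_, Or.inr ⟨i, h1, h2, rfl⟩, by simp⟩

lemma psi_inj (a : Fin (t + 2) → α) (ha : Function.Injective a) (j) :
    Function.Injective (psi a j) := by
  intro k l h
  unfold psi at h
  have e1 := edge_ne a ha j
  have e2 := fun x => (edge_ne a ha j x).symm
  split_ifs at h <;> simp_all [Fin.ext_iff, ha.eq_iff] <;> omega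

lemma psi_sub (a : Fin (t + 2) → α) (j k) : psi a j k ⊆ edge a k := by
  unfold psi
  split_ifs with h1 h2
  · simp [edge]
  · rw [h2]
  · simp [edge]

lemma psi_range (a : Fin (t + 2) → α) (j) (B) : B ∈ part a j ↔ ∃ k, psi a j k = B := by
  rw [mem_part]
  constructor
  · rintro (rfl | ⟨i, h1, h2, rfl⟩)
    · exact ⟨j, by simp [psi]⟩
    · simp only [ne_eq, Fin.ext_iff, Fin.val_castSucc, Fin.val_succ] at h1 h2
      have := i.2
      have := j.2
      by_cases h : i.val < j.val
      · refine ⟨⟨i, by omega⟩, ?_⟩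
        rw [psi, if_pos (by rw [Fin.lt_def]; exact h)]
        rfl
      · refine ⟨⟨i - 1, by omega⟩, ?_⟩
        rw [psi, if_neg (by rw [Fin.lt_def]; simp; omega),
          if_neg (by rw [Fin.ext_iff]; simp; omega)]
        congr 2
        ext
        simp
        omega
  · rintro ⟨k, rfl⟩
    unfold psi
    split_ifs with h1 h2
    · right
      refine ⟨k.castSucc, ?_, ?_, rfl⟩ <;> simp only [ne_eq, Fin.ext_iff, Fin.lt_def, Fin.val_castSucc, Fin.val_succ] at * <;> omega
    · exact Or.inl rfl
    · right
      refine ⟨k.succ, ?_, ?_, rfl⟩ <;> simp only [ne_eq, Fin.ext_iff, Fin.lt_def, Fin.val_castSucc, Fin.val_succ] at * <;> omega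

lemma part_embeds (a : Fin (t + 2) → α) (ha : Function.Injective a) (j) :
    ∃ φ : Finset α → Finset α,
      Set.BijOn φ ↑(part a j) ↑(Finset.univ.image (edge a)) ∧ ∀ B ∈ part a j, B ⊆ φ B := by
  have hl := Function.leftInverse_invFun (psi_inj a ha j)
  refine ⟨fun B => edge a (Function.invFun (psi a j) B), ⟨?_, ?_, ?_⟩, ?_⟩
  · intro B _
    simp
  · intro B hB B' hB' h
    simp only [Finset.mem_coe, psi_range] at hB hB'
    obtain ⟨k, rfl⟩ := hB
    obtain ⟨k', rfl⟩ := hB'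
    have := edge_inj a ha h
    rw [hl, hl] at this
    rw [this]
  · intro E hE
    simp only [Finset.coe_image, Finset.coe_univ, Set.image_univ, Set.mem_range] at hE
    obtain ⟨k, rfl⟩ := hE
    refine ⟨psi a j k, ?_, ?_⟩
    · simp only [Finset.mem_coe, psi_range]
      exact ⟨k, rfl⟩
    · simp only [hl k]
  · intro B hB
    rw [psi_range] at hB
    obtain ⟨k, rfl⟩ := hB
    simp only [hl k]
    exact psi_sub a j k

lemma embeds_part (a : Fin (t + 2) → α) (ha : Function.Injective a) (π : Finset (Finset α))
    (h1 : ∀ B ∈ π, B.Nonempty)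
    (h2 : ∀ B ∈ π, ∀ B' ∈ π, B ≠ B' → Disjoint B B')
    (h3 : π.sup id = Finset.univ.image a) (φ : Finset α → Finset α)
    (hφ : Set.BijOn φ ↑π ↑(Finset.univ.image (edge a))) (hs : ∀ B ∈ π, B ⊆ φ B) :
    ∃ j, π = part a j := by
  have hc : π.card = t + 1 := by
    have : π.image φ = Finset.univ.image (edge a) := by
      apply Finset.coe_injective
      rw [Finset.coe_image]
      exact hφ.image_eq
    rw [← Finset.card_image_of_injOn hφ.injOn, this,
      Finset.card_image_of_injective _ (edge_inj a ha)]
    simp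
  have hsum : ∑ B ∈ π, B.card = t + 2 := by
    have : (π.biUnion id).card = ∑ B ∈ π, B.card := Finset.card_biUnion h2
    rw [← this, ← Finset.sup_eq_biUnion, h3, Finset.card_image_of_injective _ ha]
    simp
  have hex : ∃ B ∈ π, 2 ≤ B.card := by
    by_contra! hcon
    have : ∑ B ∈ π, B.card ≤ ∑ B ∈ π, 1 :=
      Finset.sum_le_sum (fun B hB => by have := hcon B hB; omega)
    simp at this
    omega
  obtain ⟨B0, hB0, hB2⟩ := hex
  have := hφ.mapsTo hB0
  simp only [Finset.coe_image, Finset.coe_univ, Set.image_univ, Set.mem_range] at this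
  obtain ⟨j, hj⟩ := this
  have hB0e : B0 = edge a j := by
    apply Finset.eq_of_subset_of_card_le
    · rw [hj]; exact hs B0 hB0
    · rw [edge_card a ha]; exact hB2
  have hsing : ∀ B ∈ π, B ≠ B0 → B.card = 1 := by
    have e1 := Finset.add_sum_erase π Finset.card hB0
    have e2 : B0.card = 2 := by rw [hB0e, edge_card a ha]
    have e3 : ∑ B ∈ π.erase B0, 1 = ∑ B ∈ π.erase B0, B.card := by
      simp only [Finset.sum_const, Finset.card_erase_of_mem hB0, smul_eq_mul]
      omega
    rw [Finset.sum_eq_sum_iff_of_le] at e3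
    · intro B hB hne
      exact (e3 B (Finset.mem_erase.2 ⟨hne, hB⟩)).symm
    · intro B hB
      exact (h1 B (Finset.mem_of_mem_erase hB)).card_pos
  refine ⟨j, ?_⟩
  ext B
  rw [mem_part, ← hB0e]
  constructor
  · intro hB
    by_cases hne : B = B0
    · exact Or.inl hne
    right
    obtain ⟨x, rfl⟩ := Finset.card_eq_one.1 (hsing B hB hne)
    have hx : x ∈ π.sup id := Finset.mem_sup.2 ⟨{x}, hB, by simp⟩
    rw [h3] at hx
    simp only [Finset.mem_image, Finset.mem_univ, true_and] at hx
    obtain ⟨i, rfl⟩ := hx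
    have hd := h2 _ hB _ hB0 hne
    rw [Finset.disjoint_singleton_left, hB0e, mem_edge a ha] at hd
    exact ⟨i, by tauto, by tauto, rfl⟩
  · rintro (rfl | ⟨i, hi1, hi2, rfl⟩)
    · exact hB0
    · have hx : a i ∈ π.sup id := by rw [h3]; simp
      obtain ⟨B, hB, hxB⟩ := Finset.mem_sup.1 hx
      have hne : B ≠ B0 := by
        rintro rfl
        rw [id, hB0e, mem_edge a ha] at hxB
        tauto
      obtain ⟨x, rfl⟩ := Finset.card_eq_one.1 (hsing B hB hne)
      simp only [id, Finset.mem_singleton] at hxB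
      rw [hxB]
      exact hB

end FenceAux

/-- Let `t ≥ 1` and let `a₀, …, a_{t+1}` be distinct elements, with
`X = {a₀, …, a_{t+1}}` and fence cover `F = {{a₀,a₁}, {a₁,a₂}, …, {a_t,a_{t+1}}}`.
A partition `π` of `X` admits a bijection `φ` from its blocks to `F` with `B ⊆ φ B` for all
blocks `B` iff for some `0 ≤ j ≤ t` the blocks of `π` are exactly `{a_j, a_{j+1}}` together
with the singletons `{a_i}` for `i ∉ {j, j+1}`.  In particular, exactly `t + 1` partitions
of `X` fully embed in `F`. -/
theorem fence_fully_embedded_partitions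
    {α : Type*} [DecidableEq α] (t : ℕ) (ht : 1 ≤ t)
    (a : Fin (t + 2) → α) (ha : Function.Injective a) :
    (∀ π : Finset (Finset α),
      ((∀ B ∈ π, B.Nonempty) ∧
       (∀ B ∈ π, ∀ B' ∈ π, B ≠ B' → Disjoint B B') ∧
       π.sup id = Finset.univ.image a) →
      ((∃ φ : Finset α → Finset α,
          Set.BijOn φ ↑π
            ↑(Finset.univ.image
                (fun i : Fin (t + 1) => ({a i.castSucc, a i.succ} : Finset α))) ∧
          ∀ B ∈ π, B ⊆ φ B) ↔
        (∃ j : Fin (t + 1),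
          π = insert ({a j.castSucc, a j.succ} : Finset α)
            ((Finset.univ.filter
                (fun i : Fin (t + 2) => i ≠ j.castSucc ∧ i ≠ j.succ)).image
              (fun i => ({a i} : Finset α)))))) ∧
    Set.ncard {π : Finset (Finset α) |
        (∀ B ∈ π, B.Nonempty) ∧
        (∀ B ∈ π, ∀ B' ∈ π, B ≠ B' → Disjoint B B') ∧
        π.sup id = Finset.univ.image a ∧
        (∃ φ : Finset α → Finset α,
          Set.BijOn φ ↑π
            ↑(Finset.univ.image
                (fun i : Fin (t + 1) => ({a i.castSucc, a i.succ} : Finset α))) ∧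
          ∀ B ∈ π, B ⊆ φ B)} = t + 1 := by
  refine ⟨?_, ?_⟩
  · rintro π ⟨h1, h2, h3⟩
    constructor
    · rintro ⟨φ, hφ, hs⟩
      exact FenceAux.embeds_part a ha π h1 h2 h3 φ hφ hs
    · rintro ⟨j, rfl⟩
      exact FenceAux.part_embeds a ha j
  · have key : ∀ S : Set (Finset (Finset α)), S = Set.range (FenceAux.part a) →
        S.ncard = t + 1 := by
      rintro S rfl
      rw [← Set.image_univ, Set.ncard_image_of_injective _ (FenceAux.part_inj a ha),
        Set.ncard_univ]
      simp
    apply key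
    ext π
    constructor
    · rintro ⟨h1, h2, h3, φ, hφ, hs⟩
      obtain ⟨j, hj⟩ := FenceAux.embeds_part a ha π h1 h2 h3 φ hφ hs
      exact ⟨j, hj.symm⟩
    · rintro ⟨j, rfl⟩
      exact ⟨FenceAux.part_nonempty a j, FenceAux.part_disj a ha j, FenceAux.part_sup a j,
        FenceAux.part_embeds a ha j⟩
end

section
/- Let t ≥ 1 and let a_0, a_1, …, a_{t+1} be distinct elements, let X = {a_0, …, a_{t+1}}, and let F be the fence cover {{a_0, a_1}, {a_1, a_2}, …, {a_t, a_{t+1}}} of X. Then the number of pairs (π, φ), where π is a partition of X and φ is a bijection from the blocks of π to the members of F with B ⊆ φ(B) for every block B, is exactly t + 1. -/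
/-- the block of the edge `i` in the embedding that doubles the edge `j` -/
def fenceBlk {α : Type*} [DecidableEq α] {t : ℕ} (a : Fin (t + 2) → α) (j i : Fin (t + 1)) :
    Finset α := (Finset.univ.filter (fun k => Fin.predAbove j k = i)).image a

lemma fenceBlk_mem {α : Type*} [DecidableEq α] {t : ℕ} (a : Fin (t + 2) → α)
    (j i : Fin (t + 1)) (x : α) :
    x ∈ fenceBlk a j i ↔ ∃ k, Fin.predAbove j k = i ∧ a k = x := by
  simp [fenceBlk]

lemma fenceBlk_mem_a {α : Type*} [DecidableEq α] {t : ℕ} (a : Fin (t + 2) → α)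
    (ha : Function.Injective a) (j i : Fin (t + 1)) (k : Fin (t + 2)) :
    a k ∈ fenceBlk a j i ↔ Fin.predAbove j k = i := by
  rw [fenceBlk_mem]
  constructor
  · rintro ⟨k', h, h'⟩
    rw [← ha h']; exact h
  · intro h; exact ⟨k, h, rfl⟩

lemma fence_predAbove_val {t : ℕ} (j : Fin (t + 1)) (k : Fin (t + 2)) :
    (Fin.predAbove j k).val = if j.val < k.val then k.val - 1 else k.val := by
  unfold Fin.predAbove
  have h0 : j.castSucc < k ↔ j.val < k.val := by simp [Fin.lt_def]
  by_cases h : j.castSucc < k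
  · rw [dif_pos h, if_pos (h0.1 h)]; simp
  · rw [dif_neg h, if_neg (fun h' => h (h0.2 h'))]; simp

lemma fenceBlk_nonempty {α : Type*} [DecidableEq α] {t : ℕ} (a : Fin (t + 2) → α)
    (j i : Fin (t + 1)) : (fenceBlk a j i).Nonempty := by
  obtain ⟨k, hk⟩ := Fin.predAbove_surjective j i
  exact ⟨a k, (fenceBlk_mem _ _ _ _).2 ⟨k, hk, rfl⟩⟩

lemma fenceBlk_disj {α : Type*} [DecidableEq α] {t : ℕ} (a : Fin (t + 2) → α)
    (ha : Function.Injective a) (j i i' : Fin (t + 1)) (h : i ≠ i') :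
    Disjoint (fenceBlk a j i) (fenceBlk a j i') := by
  rw [Finset.disjoint_left]
  intro x hx hx'
  obtain ⟨k, hk, rfl⟩ := (fenceBlk_mem _ _ _ _).1 hx
  rw [fenceBlk_mem_a a ha] at hx'
  exact h (hk.symm.trans hx')

lemma fenceBlk_inj {α : Type*} [DecidableEq α] {t : ℕ} (a : Fin (t + 2) → α)
    (ha : Function.Injective a) (j : Fin (t + 1)) : Function.Injective (fenceBlk a j) := by
  intro i i' h
  by_contra hne
  have := fenceBlk_disj a ha j i i' hne
  rw [h, disjoint_self] at this
  exact (fenceBlk_nonempty a j i').ne_empty this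

lemma fenceBlk_sub {α : Type*} [DecidableEq α] {t : ℕ} (a : Fin (t + 2) → α)
    (j i : Fin (t + 1)) : fenceBlk a j i ⊆ {a i.castSucc, a i.succ} := by
  intro x hx
  obtain ⟨k, hk, rfl⟩ := (fenceBlk_mem _ _ _ _).1 hx
  have h := fence_predAbove_val j k
  rw [hk] at h
  have : k = i.castSucc ∨ k = i.succ := by
    simp only [Fin.ext_iff, Fin.val_castSucc, Fin.val_succ]
    split_ifs at h <;> omega
  rcases this with rfl | rfl <;> simp

lemma fence_edge_inj {α : Type*} [DecidableEq α] {t : ℕ} (a : Fin (t + 2) → α)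
    (ha : Function.Injective a) :
    Function.Injective (fun i : Fin (t + 1) => ({a i.castSucc, a i.succ} : Finset α)) := by
  intro i i' h
  simp only at h
  have h1 : a i.castSucc ∈ ({a i'.castSucc, a i'.succ} : Finset α) := by rw [← h]; simp
  have h2 : a i.succ ∈ ({a i'.castSucc, a i'.succ} : Finset α) := by rw [← h]; simp
  simp only [Finset.mem_insert, Finset.mem_singleton, ha.eq_iff, Fin.ext_iff,
    Fin.val_castSucc, Fin.val_succ] at h1 h2 ⊢
  omega

/-- combinatorial core -/
lemma fence_core {t : ℕ} (g : Fin (t + 2) → Fin (t + 1)) (hs : Function.Surjective g)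
    (hg : ∀ k, (g k).val = k.val ∨ (g k).val + 1 = k.val) : ∃ j, g = Fin.predAbove j := by
  classical
  have hstep : ∀ k : ℕ, ∀ (h : k < t + 2) (h' : k + 1 < t + 2),
      (g ⟨k, h⟩).val + 1 = k → (g ⟨k + 1, h'⟩).val + 1 = k + 1 := by
    intro k h h' hk
    obtain ⟨m, hm⟩ := hs ⟨k, by omega⟩
    have h1 := hg m
    rw [hm] at h1
    rcases h1 with h1 | h1
    · have : m = ⟨k, h⟩ := Fin.ext h1.symm
      subst this
      rw [hm] at hk
      simp at hk
    · have : m = ⟨k + 1, h'⟩ := Fin.ext h1.symm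
      subst this
      rw [hm]
  have hex : ∃ k : ℕ, ∃ h : k < t + 2, (g ⟨k, h⟩).val + 1 = k := by
    refine ⟨t + 1, by omega, ?_⟩
    have h1 := hg ⟨t + 1, by omega⟩
    have h2 := (g ⟨t + 1, by omega⟩).isLt
    simp only at h1
    omega
  obtain ⟨h0, h1⟩ := Nat.find_spec hex
  have hmin := fun m => @Nat.find_min _ _ hex m
  generalize Nat.find hex = k0 at h0 h1 hmin
  have hup : ∀ k, k0 ≤ k → ∀ h : k < t + 2, (g ⟨k, h⟩).val + 1 = k := by
    intro k hk
    induction k, hk using Nat.le_induction with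
    | base => intro h; exact h1
    | succ n hn ih => intro h; exact hstep n (by omega) h (ih (by omega))
  refine ⟨⟨k0 - 1, by omega⟩, ?_⟩
  funext k
  apply Fin.ext
  rw [fence_predAbove_val]
  simp only
  split_ifs with hlt
  · have := hup k.val (by omega) k.isLt
    simp only [Fin.eta] at this
    omega
  · have h2 := hmin k.val (by omega)
    rcases hg k with h3 | h3
    · exact h3
    · exact absurd ⟨k.isLt, h3⟩ h2

lemma fence_psi {α : Type*} [DecidableEq α] {t : ℕ} (a : Fin (t + 2) → α)
    (ha : Function.Injective a) (ψ : Fin (t + 1) → Finset α)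
    (hne : ∀ i, (ψ i).Nonempty) (hd : ∀ i i', i ≠ i' → Disjoint (ψ i) (ψ i'))
    (hc : ∀ k, ∃ i, a k ∈ ψ i)
    (hsub : ∀ i, ψ i ⊆ {a i.castSucc, a i.succ}) : ∃ j, ψ = fenceBlk a j := by
  choose g hgm using hc
  have huniq : ∀ k i, a k ∈ ψ i → g k = i := by
    intro k i h
    by_contra hn
    exact Finset.disjoint_left.1 (hd _ _ hn) (hgm k) h
  have hran : ∀ i x, x ∈ ψ i → ∃ k, a k = x := by
    intro i x hx
    have := hsub i hx
    simp only [Finset.mem_insert, Finset.mem_singleton] at this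
    rcases this with h | h
    · exact ⟨_, h.symm⟩
    · exact ⟨_, h.symm⟩
  obtain ⟨j, hj⟩ := fence_core g (by
    intro i
    obtain ⟨x, hx⟩ := hne i
    obtain ⟨k, rfl⟩ := hran i x hx
    exact ⟨k, huniq k i hx⟩) (by
    intro k
    have := hsub _ (hgm k)
    simp only [Finset.mem_insert, Finset.mem_singleton, ha.eq_iff, Fin.ext_iff,
      Fin.val_castSucc, Fin.val_succ] at this
    omega)
  refine ⟨j, ?_⟩
  funext i
  ext x
  rw [fenceBlk_mem, ← hj]
  constructor
  · intro hx
    obtain ⟨k, rfl⟩ := hran i x hx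
    exact ⟨k, huniq k i hx, rfl⟩
  · rintro ⟨k, rfl, rfl⟩
    exact hgm k


/-- Let `t ≥ 1` and let `a₀, …, a_{t+1}` be distinct elements, with
`X = {a₀, …, a_{t+1}}` and fence cover `F = {{a₀,a₁}, {a₁,a₂}, …, {a_t,a_{t+1}}}`.
The number of pairs `(π, φ)`, where `π` is a partition of `X` and `φ` is a bijection from
the blocks of `π` to the members of `F` with `B ⊆ φ B` for every block `B`, is exactly
`t + 1`. -/
theorem fence_count_full_embeddings
    {α : Type*} [DecidableEq α] (t : ℕ) (ht : 1 ≤ t)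
    (a : Fin (t + 2) → α) (ha : Function.Injective a) :
    Nat.card {p : Σ π : Finset (Finset α),
        ({B : Finset α // B ∈ π} →
          {S : Finset α // S ∈ Finset.univ.image
              (fun i : Fin (t + 1) => ({a i.castSucc, a i.succ} : Finset α))}) //
      (∀ B ∈ p.1, B.Nonempty) ∧
      (∀ B ∈ p.1, ∀ B' ∈ p.1, B ≠ B' → Disjoint B B') ∧
      p.1.sup id = Finset.univ.image a ∧
      Function.Bijective p.2 ∧
      (∀ B : {B : Finset α // B ∈ p.1}, (B : Finset α) ⊆ (p.2 B : Finset α))} = t + 1 := by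
  have hex : ∀ j : Fin (t + 1), ∀ B : {B : Finset α // B ∈ Finset.univ.image (fenceBlk a j)},
      ∃ i, fenceBlk a j i = B.1 := by
    intro j B
    obtain ⟨i, -, hi⟩ := Finset.mem_image.1 B.2
    exact ⟨i, hi⟩
  choose idx hidx using hex
  have hidx' : ∀ j i h, idx j ⟨fenceBlk a j i, h⟩ = i := by
    intro j i h
    exact fenceBlk_inj a ha j (hidx j ⟨fenceBlk a j i, h⟩)
  let φ : ∀ j : Fin (t + 1), {B : Finset α // B ∈ Finset.univ.image (fenceBlk a j)} →
      {S : Finset α // S ∈ Finset.univ.image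
        (fun i : Fin (t + 1) => ({a i.castSucc, a i.succ} : Finset α))} :=
    fun j B => ⟨{a (idx j B).castSucc, a (idx j B).succ},
      Finset.mem_image_of_mem (fun i : Fin (t + 1) => ({a i.castSucc, a i.succ} : Finset α))
        (Finset.mem_univ _)⟩
  refine Eq.trans (Eq.symm ?_) (Nat.card_fin (t + 1))
  refine Nat.card_eq_of_bijective
    (fun j => ⟨⟨Finset.univ.image (fenceBlk a j), φ j⟩, ?_, ?_, ?_, ?_, ?_⟩) ⟨?_, ?_⟩
  · intro B hB
    obtain ⟨i, -, rfl⟩ := Finset.mem_image.1 hB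
    exact fenceBlk_nonempty a j i
  · intro B hB B' hB' hne
    obtain ⟨i, -, rfl⟩ := Finset.mem_image.1 hB
    obtain ⟨i', -, rfl⟩ := Finset.mem_image.1 hB'
    exact fenceBlk_disj a ha j i i' (fun h => hne (by rw [h]))
  · ext x
    simp only [Finset.mem_sup, Finset.mem_image, Finset.mem_univ, true_and, id]
    constructor
    · rintro ⟨_, ⟨i, rfl⟩, hx⟩
      obtain ⟨k, -, hk⟩ := (fenceBlk_mem _ _ _ _).1 hx
      exact ⟨k, hk⟩
    · rintro ⟨k, rfl⟩
      exact ⟨_, ⟨Fin.predAbove j k, rfl⟩, (fenceBlk_mem_a a ha _ _ _).2 rfl⟩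
  · constructor
    · intro B B' h
      have h1 := fence_edge_inj a ha (congrArg Subtype.val h)
      apply Subtype.ext
      rw [← hidx j B, ← hidx j B', h1]
    · rintro ⟨S, hS⟩
      obtain ⟨i, -, rfl⟩ := Finset.mem_image.1 hS
      refine ⟨⟨fenceBlk a j i, Finset.mem_image_of_mem _ (Finset.mem_univ _)⟩, ?_⟩
      apply Subtype.ext
      simp only [φ, hidx']
  · intro B
    have h := fenceBlk_sub a j (idx j B)
    rw [hidx] at h
    exact h
  · intro j j' h
    have h1 : Finset.univ.image (fenceBlk a j) = Finset.univ.image (fenceBlk a j') :=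
      congrArg (fun p => p.1.1) h
    have h2 : fenceBlk a j j ∈ Finset.univ.image (fenceBlk a j') := by
      rw [← h1]; exact Finset.mem_image_of_mem _ (Finset.mem_univ _)
    obtain ⟨i, -, hi⟩ := Finset.mem_image.1 h2
    have h3 : a j.castSucc ∈ fenceBlk a j' i := by
      rw [hi, fenceBlk_mem_a a ha]; simp
    have h4 : a j.succ ∈ fenceBlk a j' i := by
      rw [hi, fenceBlk_mem_a a ha]; simp
    rw [fenceBlk_mem_a a ha] at h3 h4
    have h5 := fence_predAbove_val j' j.castSucc
    have h6 := fence_predAbove_val j' j.succ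
    rw [h3] at h5
    rw [h4] at h6
    simp only [Fin.val_castSucc, Fin.val_succ] at h5 h6
    apply Fin.ext
    split_ifs at h5 h6 <;> omega
  · rintro ⟨⟨π, f⟩, hne, hd, hc, hb, hsub⟩
    simp only at hne hd hc hb hsub
    choose ψ' hψ' using fun i : Fin (t + 1) => hb.2 ⟨{a i.castSucc, a i.succ},
      Finset.mem_image_of_mem (fun i : Fin (t + 1) => ({a i.castSucc, a i.succ} : Finset α))
        (Finset.mem_univ i)⟩
    have hall : ∀ B, ∃ i, ψ' i = B := by
      intro B
      obtain ⟨i, -, hi⟩ := Finset.mem_image.1 (f B).2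
      refine ⟨i, hb.1 ?_⟩
      rw [hψ']
      exact Subtype.ext hi
    obtain ⟨j, hj⟩ := fence_psi a ha (fun i => (ψ' i).1) (fun i => hne _ (ψ' i).2)
      (by
        intro i i' hii
        refine hd _ (ψ' i).2 _ (ψ' i').2 (fun h => hii ?_)
        have h1 : ψ' i = ψ' i' := Subtype.ext h
        have h2 := congrArg f h1
        rw [hψ', hψ'] at h2
        exact fence_edge_inj a ha (congrArg Subtype.val h2))
      (by
        intro k
        have : a k ∈ π.sup id := by rw [hc]; exact Finset.mem_image_of_mem _ (Finset.mem_univ _)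
        obtain ⟨B, hB, hk⟩ := Finset.mem_sup.1 this
        obtain ⟨i, hi⟩ := hall ⟨B, hB⟩
        exact ⟨i, by simpa [hi] using hk⟩)
      (by
        intro i
        have := hsub (ψ' i)
        rw [hψ'] at this
        exact this)
    have hπ : π = Finset.univ.image (fenceBlk a j) := by
      ext B
      rw [← hj]
      simp only [Finset.mem_image, Finset.mem_univ, true_and]
      constructor
      · intro hB
        obtain ⟨i, hi⟩ := hall ⟨B, hB⟩
        exact ⟨i, by rw [hi]⟩
      · rintro ⟨i, rfl⟩
        exact (ψ' i).2
    subst hπ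
    refine ⟨j, Subtype.ext (Sigma.ext rfl (heq_of_eq ?_))⟩
    funext B
    obtain ⟨i, rfl⟩ := hall B
    change φ j (ψ' i) = f (ψ' i)
    rw [hψ']
    apply Subtype.ext
    have h1 : idx j (ψ' i) = i :=
      fenceBlk_inj a ha j ((hidx j (ψ' i)).trans (congrFun hj i))
    simp only [φ, h1]
end

section
/- Let t ≥ 2 and let a_0, a_1, …, a_t be distinct elements, let X = {a_0, …, a_t}, and let D be the crown cover {{a_0, a_1}, {a_1, a_2}, …, {a_{t−1}, a_t}, {a_t, a_0}} of X. Then the number of pairs (π, φ), where π is a partition of X and φ is a bijection from the blocks of π to the members of D with B ⊆ φ(B) for every block B, is exactly 2. -/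
namespace CrownAux

theorem one_ne {t : ℕ} (ht : 2 ≤ t) (i : Fin (t+1)) : i + 1 ≠ i := by
  intro h
  have h1 : (1 : Fin (t+1)) = 0 := by simpa using h
  have := congrArg Fin.val h1
  simp [Fin.val_one', Nat.mod_eq_of_lt (show 1 < t + 1 by omega)] at this
  try omega

theorem two_ne {t : ℕ} (ht : 2 ≤ t) (i : Fin (t+1)) : i + 1 + 1 ≠ i := by
  intro h
  rw [add_assoc] at h
  have h1 : (1 : Fin (t+1)) + 1 = 0 := by simpa using h
  have := congrArg Fin.val h1
  rw [Fin.val_add, Fin.val_one', Nat.mod_eq_of_lt (show 1 < t + 1 by omega),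
    Nat.mod_eq_of_lt (show 1 + 1 < t + 1 by omega)] at this
  simp at this

theorem edge_inj {α : Type*} [DecidableEq α] {t : ℕ} (ht : 2 ≤ t)
    (a : Fin (t + 1) → α) (ha : Function.Injective a) :
    Function.Injective (fun i : Fin (t + 1) => ({a i, a (i + 1)} : Finset α)) := by
  intro i j h
  simp only at h
  have h1 : a i ∈ ({a j, a (j+1)} : Finset α) := by rw [← h]; simp
  have h2 : a (i+1) ∈ ({a j, a (j+1)} : Finset α) := by rw [← h]; simp
  simp only [Finset.mem_insert, Finset.mem_singleton, ha.eq_iff] at h1 h2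
  rcases h1 with h1 | h1
  · exact h1
  · rcases h2 with h2 | h2
    · subst h1; exact absurd h2 (two_ne ht j)
    · exact add_right_cancel h2

open scoped Fin.NatCast Fin.CommRing in
theorem cyc {t : ℕ} (P : Fin (t+1) → Prop) (hs : ∀ i, P i → P (i+1)) (i : Fin (t+1)) (hi : P i) :
    ∀ j, P j := by
  intro j
  have key : ∀ k : ℕ, P (i + (k : Fin (t+1))) := by
    intro k
    induction k with
    | zero => simpa using hi
    | succ k ih => 
      have := hs _ ih
      rw [add_assoc] at this
      simpa using this
  have := key (j - i).val
  simpa using this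

theorem two_maps {t : ℕ} (ht : 2 ≤ t) (f : Fin (t+1) → Fin (t+1)) (hf : Function.Injective f)
    (h : ∀ i, i = f i ∨ i = f i + 1) : (∀ i, f i = i) ∨ (∀ i, f i = i - 1) := by
  by_cases hx : ∃ i, f i = i
  · left
    obtain ⟨i, hi⟩ := hx
    refine cyc (fun i => f i = i) ?_ i hi
    intro i hi
    rcases h (i+1) with h1 | h1
    · exact h1.symm
    · have h2 : f (i+1) = f i := by rw [hi]; exact (add_right_cancel h1).symm
      exact absurd (hf h2) (one_ne ht i)
  · right
    push Not at hx
    intro i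
    rcases h i with h1 | h1
    · exact absurd h1.symm (hx i)
    · exact eq_sub_of_add_eq h1.symm

theorem blocks {α : Type*} [DecidableEq α] {t : ℕ}
    (a : Fin (t + 1) → α) (ha : Function.Injective a) (π : Finset (Finset α))
    (h1 : ∀ B ∈ π, B.Nonempty) (h2 : ∀ B ∈ π, ∀ B' ∈ π, B ≠ B' → Disjoint B B')
    (h3 : π.sup id = Finset.univ.image a) (hc : π.card = t + 1) :
    π = Finset.univ.image (fun i => ({a i} : Finset α)) := by
  have hsum : ∑ B ∈ π, B.card = t + 1 := by
    have := Finset.card_biUnion (s := π) (t := id) (fun x hx y hy hxy => h2 x hx y hy hxy)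
    rw [← Finset.sup_eq_biUnion, h3, Finset.card_image_of_injective _ ha] at this
    simpa using this.symm
  have hone : ∀ B ∈ π, 1 = B.card := by
    apply (Finset.sum_eq_sum_iff_of_le (fun B hB => Finset.card_pos.mpr (h1 B hB))).mp
    rw [hsum]; simp [hc]
  apply Finset.eq_of_subset_of_card_le
  · intro B hB
    obtain ⟨x, rfl⟩ := Finset.card_eq_one.mp (hone B hB).symm
    have hx : x ∈ Finset.univ.image a := by
      rw [← h3, Finset.mem_sup]
      exact ⟨_, hB, by simp⟩
    obtain ⟨i, -, rfl⟩ := Finset.mem_image.mp hx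
    exact Finset.mem_image_of_mem _ (Finset.mem_univ i)
  · rw [hc]
    exact Finset.card_image_le.trans (by simp)

theorem idx_ex {α : Type*} [DecidableEq α] {t : ℕ} (a : Fin (t + 1) → α)
    (B : {B : Finset α // B ∈ Finset.univ.image (fun i => ({a i} : Finset α))}) :
    ∃ i, {a i} = B.1 := by
  obtain ⟨i, -, h⟩ := Finset.mem_image.mp B.2
  exact ⟨i, h⟩

noncomputable def mk {α : Type*} [DecidableEq α] {t : ℕ} (a : Fin (t + 1) → α)
    (g : Fin (t+1) → Fin (t+1)) : Σ π : Finset (Finset α),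
        ({B : Finset α // B ∈ π} →
          {S : Finset α // S ∈ Finset.univ.image
              (fun i : Fin (t + 1) => ({a i, a (i + 1)} : Finset α))}) :=
  ⟨Finset.univ.image (fun i => ({a i} : Finset α)), fun B =>
    ⟨{a (g (idx_ex a B).choose), a (g (idx_ex a B).choose + 1)},
      Finset.mem_image_of_mem (fun i : Fin (t + 1) => ({a i, a (i + 1)} : Finset α))
        (Finset.mem_univ _)⟩⟩

theorem mk_valid {α : Type*} [DecidableEq α] {t : ℕ} (ht : 2 ≤ t) (a : Fin (t + 1) → α)
    (ha : Function.Injective a)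
    (g : Fin (t+1) → Fin (t+1)) (hg : Function.Bijective g) (h : ∀ i, i = g i ∨ i = g i + 1) :
      (∀ B ∈ (mk a g).1, B.Nonempty) ∧
      (∀ B ∈ (mk a g).1, ∀ B' ∈ (mk a g).1, B ≠ B' → Disjoint B B') ∧
      (mk a g).1.sup id = Finset.univ.image a ∧
      Function.Bijective (mk a g).2 ∧
      (∀ B : {B : Finset α // B ∈ (mk a g).1}, (B : Finset α) ⊆ ((mk a g).2 B : Finset α)) := by
  refine ⟨?_, ?_, ?_, ⟨?_, ?_⟩, ?_⟩
  · intro B hB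
    obtain ⟨i, -, rfl⟩ := Finset.mem_image.mp hB
    simp
  · intro B hB B' hB' hne
    obtain ⟨i, -, rfl⟩ := Finset.mem_image.mp hB
    obtain ⟨j, -, rfl⟩ := Finset.mem_image.mp hB'
    simp only [Finset.disjoint_singleton]
    intro h
    exact hne (by rw [h])
  · ext x
    simp [mk, Finset.mem_sup, eq_comm]
  · intro B B' hBB
    have h1 := hg.1 (edge_inj ht a ha (congrArg Subtype.val hBB))
    apply Subtype.ext
    rw [← (idx_ex a B).choose_spec, ← (idx_ex a B').choose_spec, h1]
  · rintro ⟨S, hS⟩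
    obtain ⟨j, -, rfl⟩ := Finset.mem_image.mp hS
    obtain ⟨i, rfl⟩ := hg.2 j
    refine ⟨⟨{a i}, Finset.mem_image_of_mem _ (Finset.mem_univ i)⟩, ?_⟩
    have := (idx_ex a ⟨{a i}, Finset.mem_image_of_mem _ (Finset.mem_univ i)⟩).choose_spec
    have h2 := ha (Finset.singleton_injective this)
    apply Subtype.ext
    simp only [mk]
    rw [h2]
  · intro B
    have h1 := (idx_ex a B).choose_spec
    rw [← h1, Finset.singleton_subset_iff]
    simp only [mk, Finset.mem_insert, Finset.mem_singleton, ha.eq_iff]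
    exact h _

theorem mk_of_valid {α : Type*} [DecidableEq α] {t : ℕ} (ht : 2 ≤ t) (a : Fin (t + 1) → α)
    (ha : Function.Injective a) (p : Σ π : Finset (Finset α),
        ({B : Finset α // B ∈ π} →
          {S : Finset α // S ∈ Finset.univ.image
              (fun i : Fin (t + 1) => ({a i, a (i + 1)} : Finset α))}))
    (hp : (∀ B ∈ p.1, B.Nonempty) ∧
      (∀ B ∈ p.1, ∀ B' ∈ p.1, B ≠ B' → Disjoint B B') ∧
      p.1.sup id = Finset.univ.image a ∧
      Function.Bijective p.2 ∧
      (∀ B : {B : Finset α // B ∈ p.1}, (B : Finset α) ⊆ (p.2 B : Finset α))) :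
    p = mk a id ∨ p = mk a (fun i => i - 1) := by
  obtain ⟨π, φ⟩ := p
  obtain ⟨h1, h2, h3, h4, h5⟩ := hp
  simp only at h1 h2 h3 h4 h5
  have hc : π.card = t + 1 := by
    have := Fintype.card_of_bijective h4
    rw [Fintype.card_coe, Fintype.card_coe,
      Finset.card_image_of_injective _ (edge_inj ht a ha)] at this
    simpa using this
  obtain rfl := blocks a ha π h1 h2 h3 hc
  have hex : ∀ B, ∃ j, ({a j, a (j+1)} : Finset α) = (φ B).1 := by
    intro B
    obtain ⟨j, -, h⟩ := Finset.mem_image.mp (φ B).2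
    exact ⟨j, h⟩
  choose F hF using hex
  let s : Fin (t+1) → {B : Finset α // B ∈ Finset.univ.image (fun i => ({a i} : Finset α))} :=
    fun i => ⟨{a i}, Finset.mem_image_of_mem _ (Finset.mem_univ i)⟩
  have hfin : ∀ g : Fin (t+1) → Fin (t+1), (∀ i, F (s i) = g i) → 
      (⟨_, φ⟩ : Σ π : Finset (Finset α),
        ({B : Finset α // B ∈ π} →
          {S : Finset α // S ∈ Finset.univ.image
              (fun i : Fin (t + 1) => ({a i, a (i + 1)} : Finset α))})) = mk a g := by
    intro g hg
    unfold mk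
    congr 1
    funext B
    apply Subtype.ext
    simp only
    rw [← hF, ← hg]
    have : s (idx_ex a B).choose = B := Subtype.ext (idx_ex a B).choose_spec
    rw [this]
  have hA : Function.Injective (fun i => F (s i)) := by
    intro i j hij
    simp only at hij
    have : φ (s i) = φ (s j) := by
      apply Subtype.ext
      rw [← hF, ← hF, hij]
    have := congrArg Subtype.val (h4.1 this)
    exact ha (Finset.singleton_injective this)
  have hB : ∀ i, i = F (s i) ∨ i = F (s i) + 1 := by
    intro i
    have := h5 (s i)
    rw [← hF] at this
    simpa [s, ha.eq_iff] using this
  rcases two_maps ht (fun i => F (s i)) hA hB with h | h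
  · left; exact hfin _ h
  · right; exact hfin _ h

theorem mk_ne {α : Type*} [DecidableEq α] {t : ℕ} (ht : 2 ≤ t) (a : Fin (t + 1) → α)
    (ha : Function.Injective a) : mk a id ≠ mk a (fun i => i - 1) := by
  intro h
  unfold mk at h
  have h := eq_of_heq (Sigma.mk.inj h).2
  have h := congrArg Subtype.val
    (congrFun h ⟨{a 0}, Finset.mem_image_of_mem _ (Finset.mem_univ 0)⟩)
  have h := edge_inj ht a ha h
  exact one_ne ht _ (eq_sub_iff_add_eq.mp h)

end CrownAux


/-- Let `t ≥ 2` and let `a₀, …, a_t` be distinct elements, with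
`X = {a₀, …, a_t}` and crown cover `D = {{a₀,a₁}, {a₁,a₂}, …, {a_{t-1},a_t}, {a_t,a₀}}`
(indices cyclic).  The number of pairs `(π, φ)`, where `π` is a partition of `X` and `φ` is
a bijection from the blocks of `π` to the members of `D` with `B ⊆ φ B` for every block
`B`, is exactly `2`. -/
theorem crown_count_full_embeddings
    {α : Type*} [DecidableEq α] (t : ℕ) (ht : 2 ≤ t)
    (a : Fin (t + 1) → α) (ha : Function.Injective a) :
    Nat.card {p : Σ π : Finset (Finset α),
        ({B : Finset α // B ∈ π} →
          {S : Finset α // S ∈ Finset.univ.image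
              (fun i : Fin (t + 1) => ({a i, a (i + 1)} : Finset α))}) //
      (∀ B ∈ p.1, B.Nonempty) ∧
      (∀ B ∈ p.1, ∀ B' ∈ p.1, B ≠ B' → Disjoint B B') ∧
      p.1.sup id = Finset.univ.image a ∧
      Function.Bijective p.2 ∧
      (∀ B : {B : Finset α // B ∈ p.1}, (B : Finset α) ⊆ (p.2 B : Finset α))} = 2 := by
  rw [Nat.card_eq_two_iff]
  refine ⟨⟨CrownAux.mk a id, CrownAux.mk_valid ht a ha id Function.bijective_id
      (fun i => Or.inl rfl)⟩,
    ⟨CrownAux.mk a (fun i => i - 1), CrownAux.mk_valid ht a ha _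
      (Equiv.subRight (1 : Fin (t+1))).bijective (fun i => Or.inr (by simp))⟩, ?_, ?_⟩
  · intro h
    exact CrownAux.mk_ne ht a ha (congrArg Subtype.val h)
  · rw [Set.eq_univ_iff_forall]
    rintro ⟨p, hp⟩
    rcases CrownAux.mk_of_valid ht a ha p hp with h | h
    · left; exact Subtype.ext h
    · right; exact Subtype.ext h
end

section
/- Let C be an expanding cover of [m] such that every member of C has at most two elements, every element of [m] lies in at most two members of C, and every member of C contains an element that lies in exactly one member of C. Let k be the number of elements of [m] that lie in exactly two members of C. Then the number of pairs (π, φ), where π is a partition of [m] and φ is a bijection from the blocks of π to the members of C with B ⊆ φ(B) for every block B, is exactly 2^k. -/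
/-- Let `C` be an expanding cover of `[m]` in which every member has at
most two elements, every element of `[m]` lies in at most two members, and every member
contains an element lying in exactly one member (the binary tree-child condition).  If `k`
is the number of elements of `[m]` lying in exactly two members of `C`, then the number of
pairs `(π, φ)`, with `π` a partition of `[m]` and `φ` a bijection from the blocks of `π` to
the members of `C` satisfying `B ⊆ φ B` for every block `B`, is exactly `2 ^ k`. -/
theorem binary_treechild_count_support_trees
    (m : ℕ) (hm : 0 < m) (C : Finset (Finset ℕ))
    (hne : ∀ S ∈ C, S.Nonempty)
    (hunion : C.sup id = Finset.Icc 1 m)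
    (hexp1 : ∀ x ∈ Finset.Icc 1 (m - C.card + 1),
        (C.filter (fun S => x ∈ S)).card ≤ 1)
    (hexp2 : ∀ i, 1 ≤ i → i ≤ C.card →
        i ≤ (C.filter (fun S => S ⊆ Finset.Icc 1 (m - C.card + 1 + i - 1))).card)
    (hsmall : ∀ S ∈ C, S.card ≤ 2)
    (hdeg : ∀ x ∈ Finset.Icc 1 m, (C.filter (fun S => x ∈ S)).card ≤ 2)
    (htc : ∀ S ∈ C, ∃ x ∈ S, (C.filter (fun T => x ∈ T)).card = 1) :
    Nat.card {p : Σ π : Finset (Finset ℕ),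
        ({B : Finset ℕ // B ∈ π} → {S : Finset ℕ // S ∈ C}) //
      (∀ B ∈ p.1, B.Nonempty) ∧
      (∀ B ∈ p.1, ∀ B' ∈ p.1, B ≠ B' → Disjoint B B') ∧
      p.1.sup id = Finset.Icc 1 m ∧
      Function.Bijective p.2 ∧
      (∀ B : {B : Finset ℕ // B ∈ p.1}, (B : Finset ℕ) ⊆ (p.2 B : Finset ℕ))} =
    2 ^ ((Finset.Icc 1 m).filter
          (fun x => (C.filter (fun S => x ∈ S)).card = 2)).card := by
  classical
  have hmemC : ∀ S ∈ C, ∀ x ∈ S, x ∈ Finset.Icc 1 m := by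
    intro S hS x hx
    rw [← hunion, Finset.mem_sup]
    exact ⟨S, hS, hx⟩
  have hpos : ∀ x ∈ Finset.Icc 1 m, 1 ≤ (C.filter (fun S => x ∈ S)).card := by
    intro x hx
    rw [← hunion, Finset.mem_sup] at hx
    obtain ⟨S, hS, hxS⟩ := hx
    exact Finset.card_pos.mpr ⟨S, Finset.mem_filter.mpr ⟨hS, hxS⟩⟩
  have hcount : Nat.card (∀ x : {x // x ∈ Finset.Icc 1 m},
      {S // S ∈ C.filter (fun S => (x : ℕ) ∈ S)}) =
      2 ^ ((Finset.Icc 1 m).filter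
          (fun x => (C.filter (fun S => x ∈ S)).card = 2)).card := by
    rw [Nat.card_pi]
    simp only [Nat.card_eq_fintype_card, Fintype.card_coe]
    rw [Finset.prod_coe_sort (Finset.Icc 1 m) (fun x => (C.filter (fun S => x ∈ S)).card)]
    rw [← Finset.prod_const, Finset.prod_filter]
    refine Finset.prod_congr rfl ?_
    intro x hx
    have h1 := hpos x hx
    have h2 := hdeg x hx
    split_ifs with h
    · exact h
    · omega
  rw [← hcount]
  have key : ∀ p : {p : Σ π : Finset (Finset ℕ),
        ({B : Finset ℕ // B ∈ π} → {S : Finset ℕ // S ∈ C}) //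
      (∀ B ∈ p.1, B.Nonempty) ∧
      (∀ B ∈ p.1, ∀ B' ∈ p.1, B ≠ B' → Disjoint B B') ∧
      p.1.sup id = Finset.Icc 1 m ∧
      Function.Bijective p.2 ∧
      (∀ B : {B : Finset ℕ // B ∈ p.1}, (B : Finset ℕ) ⊆ (p.2 B : Finset ℕ))},
      ∃ f : (∀ x : {x // x ∈ Finset.Icc 1 m}, {S // S ∈ C.filter (fun S => (x : ℕ) ∈ S)}),
        ∀ (B : {B : Finset ℕ // B ∈ p.1.1}) (x : {x // x ∈ Finset.Icc 1 m}),
          ((x : ℕ) ∈ (B : Finset ℕ) ↔ (f x : Finset ℕ) = p.1.2 B) := by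
    rintro ⟨⟨π, φ⟩, h1, h2, h3, h4, h5⟩
    dsimp only at *
    have hb : ∀ x : {x // x ∈ Finset.Icc 1 m}, ∃ B : {B : Finset ℕ // B ∈ π},
        (x : ℕ) ∈ (B : Finset ℕ) := by
      rintro ⟨x, hx⟩
      rw [← h3, Finset.mem_sup] at hx
      obtain ⟨B, hB, hxB⟩ := hx
      exact ⟨⟨B, hB⟩, hxB⟩
    choose b hb using hb
    refine ⟨fun x => ⟨φ (b x), Finset.mem_filter.mpr ⟨(φ (b x)).2, h5 _ (hb x)⟩⟩, ?_⟩
    intro B x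
    constructor
    · intro hx
      have : b x = B := by
        by_contra hne'
        exact Finset.disjoint_left.mp (h2 _ (b x).2 _ B.2 (fun h => hne' (Subtype.ext h)))
          (hb x) hx
      simp [this]
    · intro h
      have : b x = B := h4.1 (Subtype.ext h)
      rw [← this]
      exact hb x
  choose F hF using key
  refine Nat.card_eq_of_bijective F ⟨?_, ?_⟩
  · have sub : ∀ p p', F p = F p' → ∀ B (hB : B ∈ p.1.1), ∃ hB' : B ∈ p'.1.1,
        p'.1.2 ⟨B, hB'⟩ = p.1.2 ⟨B, hB⟩ := by
      intro p p' hpp B hB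
      obtain ⟨B', hB'⟩ := p'.2.2.2.2.1.2 (p.1.2 ⟨B, hB⟩)
      have e : B = B' := by
        ext x
        constructor
        · intro hx
          have hxm : x ∈ Finset.Icc 1 m := by
            rw [← p.2.2.2.1, Finset.mem_sup]
            exact ⟨B, hB, hx⟩
          have := (hF p ⟨B, hB⟩ ⟨x, hxm⟩).1 hx
          refine (hF p' B' ⟨x, hxm⟩).2 ?_
          rw [← hpp, this, hB']
        · intro hx
          have hxm : x ∈ Finset.Icc 1 m := by
            rw [← p'.2.2.2.1, Finset.mem_sup]
            exact ⟨B', B'.2, hx⟩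
          have := (hF p' B' ⟨x, hxm⟩).1 hx
          refine (hF p ⟨B, hB⟩ ⟨x, hxm⟩).2 ?_
          rw [hpp, this, hB']
      subst e
      exact ⟨B'.2, hB'⟩
    intro p p' hpp
    have s1 := sub p p' hpp
    have s2 := sub p' p hpp.symm
    clear sub hpp
    obtain ⟨⟨π, φ⟩, hp⟩ := p
    obtain ⟨⟨π', φ'⟩, hp'⟩ := p'
    dsimp only at s1 s2
    have e : π = π' := by
      ext B
      exact ⟨fun h => (s1 B h).1, fun h => (s2 B h).1⟩
    subst e
    have e2 : φ = φ' := by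
      funext B
      exact (s1 B.1 B.2).2.symm
    subst e2
    rfl
  · intro f
    let fib : {S : Finset ℕ // S ∈ C} → Finset ℕ := fun S =>
      (Finset.Icc 1 m).filter (fun x => ∃ h : x ∈ Finset.Icc 1 m, (f ⟨x, h⟩ : Finset ℕ) = S)
    have hfib : ∀ S x, x ∈ fib S ↔ ∃ h : x ∈ Finset.Icc 1 m, (f ⟨x, h⟩ : Finset ℕ) = S := by
      intro S x
      simp only [fib, Finset.mem_filter]
      exact ⟨fun h => h.2, fun h => ⟨h.1, h⟩⟩
    have hfne : ∀ S, (fib S).Nonempty := by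
      rintro ⟨S, hS⟩
      obtain ⟨x, hx, hc⟩ := htc S hS
      have hxm := hmemC S hS x hx
      refine ⟨x, (hfib _ _).2 ⟨hxm, ?_⟩⟩
      exact Finset.card_le_one.mp hc.le _ (f ⟨x, hxm⟩).2 _ (Finset.mem_filter.mpr ⟨hS, hx⟩)
    have huniq : ∀ S S' x, x ∈ fib S → x ∈ fib S' → S = S' := by
      intro S S' x h h'
      obtain ⟨_, h⟩ := (hfib _ _).1 h
      obtain ⟨_, h'⟩ := (hfib _ _).1 h'
      exact Subtype.ext (h.symm.trans h')
    have hinj : Function.Injective fib := by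
      intro S S' h
      obtain ⟨x, hx⟩ := hfne S
      exact huniq S S' x hx (h ▸ hx)
    let π : Finset (Finset ℕ) := Finset.univ.image fib
    have hπ : ∀ B : {B : Finset ℕ // B ∈ π}, ∃ S, fib S = B := by
      rintro ⟨B, hB⟩
      simpa [π] using hB
    have hπ' : ∀ S, fib S ∈ π := fun S => Finset.mem_image_of_mem _ (Finset.mem_univ _)
    choose φ hφ using hπ
    have hφ' : ∀ S, φ ⟨fib S, hπ' S⟩ = S := fun S => hinj (hφ _)
    have hfC : ∀ x, (f x : Finset ℕ) ∈ C := fun x => (Finset.mem_filter.mp (f x).2).1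
    refine ⟨⟨⟨π, φ⟩, ?_, ?_, ?_, ⟨?_, ?_⟩, ?_⟩, ?_⟩
    · intro B hB
      have h := hfne (φ ⟨B, hB⟩)
      rw [hφ] at h
      exact h
    · intro B hB B' hB' hne'
      rw [Finset.disjoint_left]
      intro x hx hx'
      apply hne'
      have e1 := hφ ⟨B, hB⟩
      have e2 := hφ ⟨B', hB'⟩
      dsimp only at e1 e2
      rw [← e1] at hx
      rw [← e2] at hx'
      rw [← e1, ← e2, huniq _ _ x hx hx']
    · ext x
      rw [Finset.mem_sup]
      constructor
      · rintro ⟨B, hB, hx⟩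
        have e1 := hφ ⟨B, hB⟩
        dsimp only [id] at e1 hx
        rw [← e1] at hx
        exact ((hfib _ _).1 hx).1
      · intro hx
        exact ⟨_, hπ' ⟨f ⟨x, hx⟩, hfC _⟩, (hfib _ _).2 ⟨hx, rfl⟩⟩
    · intro B B' h
      have h : φ B = φ B' := h
      apply Subtype.ext
      rw [← hφ B, ← hφ B', h]
    · intro S
      exact ⟨_, hφ' S⟩
    · intro B x hx
      rw [← hφ B] at hx
      obtain ⟨h, e⟩ := (hfib _ _).1 hx
      have := (Finset.mem_filter.mp (f ⟨x, h⟩).2).2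
      rw [e] at this
      exact this
    · funext x
      apply Subtype.ext
      have hx : (x : ℕ) ∈ fib ⟨f x, hfC x⟩ := (hfib _ _).2 ⟨x.2, rfl⟩
      refine ((hF _ ?B x).1 ?h1).trans ?h2
      case B => exact ⟨fib ⟨f x, hfC x⟩, hπ' _⟩
      case h1 => exact hx
      exact congrArg Subtype.val (hφ' ⟨f x, hfC x⟩)
end

section
/- Let C be an expanding cover of [m]. Then the number of pairs (π, φ), where π is a partition of [m] and φ is an injective map from the blocks of π to the members of C with B ⊆ φ(B) for every block B, equals the product over all x ∈ [m] of the number of members of C that contain x. -/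
theorem sigma_ext_aux {C : Finset (Finset ℕ)}
    (p q : Σ π : Finset (Finset ℕ), ({B : Finset ℕ // B ∈ π} → {S : Finset ℕ // S ∈ C}))
    (h : ∀ B, B ∈ p.1 ↔ B ∈ q.1)
    (h2 : ∀ B (hp : B ∈ p.1) (hq : B ∈ q.1), (p.2 ⟨B, hp⟩ : Finset ℕ) = q.2 ⟨B, hq⟩) : p = q := by
  obtain ⟨p1, p2⟩ := p
  obtain ⟨q1, q2⟩ := q
  obtain rfl : p1 = q1 := Finset.ext h
  congr 1
  funext B
  exact Subtype.ext (h2 B.1 B.2 B.2)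

def GoodPair (V : Finset ℕ) (C : Finset (Finset ℕ))
    (p : Σ π : Finset (Finset ℕ), ({B : Finset ℕ // B ∈ π} → {S : Finset ℕ // S ∈ C})) : Prop :=
  (∀ B ∈ p.1, B.Nonempty) ∧
  (∀ B ∈ p.1, ∀ B' ∈ p.1, B ≠ B' → Disjoint B B') ∧
  p.1.sup id = V ∧
  Function.Injective p.2 ∧
  (∀ B : {B : Finset ℕ // B ∈ p.1}, (B : Finset ℕ) ⊆ (p.2 B : Finset ℕ))

def RelPair {V : Finset ℕ} {C : Finset (Finset ℕ)}
    (p : Σ π : Finset (Finset ℕ), ({B : Finset ℕ // B ∈ π} → {S : Finset ℕ // S ∈ C}))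
    (f : ∀ x : V, {S // S ∈ C.filter (fun S => x.1 ∈ S)}) : Prop :=
  ∀ B (h : B ∈ p.1) (x : V), x.1 ∈ B → (p.2 ⟨B, h⟩ : Finset ℕ) = f x

theorem GoodPair.mem {V C p} (hp : GoodPair V C p) (x : ℕ) : x ∈ V ↔ ∃ B ∈ p.1, x ∈ B := by
  rw [← hp.2.2.1]; simp [Finset.mem_sup]

theorem RelPair.block {V C p} (hp : GoodPair V C p) {f} (h : RelPair (V := V) p f)
    (B) (hB : B ∈ p.1) (y : V) : y.1 ∈ B ↔ (f y : Finset ℕ) = p.2 ⟨B, hB⟩ := by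
  constructor
  · intro hy; exact (h B hB y hy).symm
  · intro hy
    obtain ⟨B', hB', hyB'⟩ := (hp.mem y).1 y.2
    have h1 := h B' hB' y hyB'
    have h2 : p.2 ⟨B', hB'⟩ = p.2 ⟨B, hB⟩ := Subtype.ext (h1.trans hy)
    have h3 := hp.2.2.2.1 h2
    simp only [Subtype.mk.injEq] at h3
    exact h3 ▸ hyB'

theorem RelPair.sub {V C p q} (hp : GoodPair V C p) (hq : GoodPair V C q) {f}
    (h : RelPair (V := V) p f) (h' : RelPair (V := V) q f) (B) (hB : B ∈ p.1) : B ∈ q.1 := by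
  obtain ⟨x, hx⟩ := hp.1 B hB
  have hxV : x ∈ V := (hp.mem x).2 ⟨B, hB, hx⟩
  obtain ⟨B', hB', hxB'⟩ := (hq.mem x).1 hxV
  suffices B = B' by rwa [this]
  ext y
  have e1 := h B hB ⟨x, hxV⟩ hx
  have e2 := h' B' hB' ⟨x, hxV⟩ hxB'
  constructor
  · intro hy
    have hyV : y ∈ V := (hp.mem y).2 ⟨B, hB, hy⟩
    exact (h'.block hq B' hB' ⟨y, hyV⟩).2 (((h.block hp B hB ⟨y, hyV⟩).1 hy).trans (e1.trans e2.symm))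
  · intro hy
    have hyV : y ∈ V := (hq.mem y).2 ⟨B', hB', hy⟩
    exact (h.block hp B hB ⟨y, hyV⟩).2
      (((h'.block hq B' hB' ⟨y, hyV⟩).1 hy).trans (e2.trans e1.symm))

theorem exists_fun {V C p} (hp : GoodPair V C p) : ∃ f, RelPair (V := V) p f := by
  have : ∀ x : V, ∃ B, ∃ h : B ∈ p.1, x.1 ∈ B := fun x => by simpa using (hp.mem x).1 x.2
  choose b hb hxb using this
  refine ⟨fun x => ⟨p.2 ⟨b x, hb x⟩, ?_⟩, ?_⟩
  · exact Finset.mem_filter.2 ⟨(p.2 _).2, hp.2.2.2.2 ⟨b x, hb x⟩ (hxb x)⟩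
  · intro B hB x hx
    have : B = b x := by
      by_contra hne
      exact Finset.disjoint_left.1 (hp.2.1 B hB _ (hb x) hne) hx (hxb x)
    subst this
    rfl

theorem exists_pair {V : Finset ℕ} {C : Finset (Finset ℕ)}
    (f : ∀ x : V, {S // S ∈ C.filter (fun S => x.1 ∈ S)}) :
    ∃ p, GoodPair V C p ∧ RelPair p f := by
  let fib : V → Finset ℕ := fun x => (V.attach.filter (fun y => (f y : Finset ℕ) = f x)).image (·.1)
  have hfib : ∀ (x y : V), y.1 ∈ fib x ↔ (f y : Finset ℕ) = f x := by
    intro x y; simp [fib]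
  have hfibV : ∀ x y, y ∈ fib x → y ∈ V := by
    intro x y h
    simp only [fib, Finset.mem_image] at h
    obtain ⟨a, _, rfl⟩ := h
    exact a.2
  have hch : ∀ B : {B // B ∈ V.attach.image fib}, ∃ x, fib x = B.1 := by
    intro B; obtain ⟨x, -, h⟩ := Finset.mem_image.1 B.2; exact ⟨x, h⟩
  choose r hr using hch
  have key : ∀ (B : {B // B ∈ V.attach.image fib}) (x : V), x.1 ∈ B.1 ↔ (f x : Finset ℕ) = f (r B) := by
    intro B x; have := hfib (r B) x; rwa [hr B] at this
  refine ⟨⟨V.attach.image fib, fun B => ⟨f (r B), (Finset.mem_filter.1 (f (r B)).2).1⟩⟩,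
    ⟨?_, ?_, ?_, ?_, ?_⟩, ?_⟩
  · intro B hB
    exact ⟨r ⟨B, hB⟩, (key ⟨B, hB⟩ _).2 rfl⟩
  · intro B hB B' hB' hne
    rw [Finset.disjoint_left]
    intro y hy hy'
    apply hne
    have hyV : y ∈ V := hfibV (r ⟨B, hB⟩) y (by rw [hr]; exact hy)
    have e1 := (key ⟨B, hB⟩ ⟨y, hyV⟩).1 hy
    have e2 := (key ⟨B', hB'⟩ ⟨y, hyV⟩).1 hy'
    have e3 : fib (r ⟨B, hB⟩) = fib (r ⟨B', hB'⟩) := by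
      simp only [fib, ← e1, ← e2]
    rw [hr, hr] at e3
    exact e3
  · ext y
    simp only [Finset.mem_sup, Finset.mem_image, id]
    constructor
    · rintro ⟨B, ⟨x, -, rfl⟩, hy⟩
      exact hfibV _ _ hy
    · intro hy
      exact ⟨fib ⟨y, hy⟩, ⟨⟨y, hy⟩, Finset.mem_attach _ _, rfl⟩, (hfib ⟨y, hy⟩ ⟨y, hy⟩).2 rfl⟩
  · intro B B' h
    have h' : (f (r B) : Finset ℕ) = f (r B') := congrArg Subtype.val h
    apply Subtype.ext
    rw [← hr B, ← hr B']
    simp only [fib, h']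
  · intro B y hy
    have hyV : y ∈ V := hfibV (r B) y (by rw [hr]; exact hy)
    have e1 := (key B ⟨y, hyV⟩).1 hy
    have e2 := (Finset.mem_filter.1 (f ⟨y, hyV⟩).2).2
    rw [e1] at e2
    exact e2
  · intro B hB x hx
    exact ((key ⟨B, hB⟩ x).1 hx).symm

theorem card_goodPair (V : Finset ℕ) (C : Finset (Finset ℕ)) :
    Nat.card {p // GoodPair V C p} = ∏ x ∈ V, (C.filter (fun S => x ∈ S)).card := by
  choose F hF using fun p : {p // GoodPair V C p} => exists_fun p.2
  have hbij : Function.Bijective F := by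
    constructor
    · intro p q h
      have h1 := hF p
      have h2 := hF q
      rw [← h] at h2
      apply Subtype.ext
      refine sigma_ext_aux _ _ (fun B => ⟨h1.sub p.2 q.2 h2 B, h2.sub q.2 p.2 h1 B⟩) ?_
      intro B hB hB'
      obtain ⟨x, hx⟩ := p.2.1 B hB
      have hxV : x ∈ V := (p.2.mem x).2 ⟨B, hB, hx⟩
      exact (h1 B hB ⟨x, hxV⟩ hx).trans (h2 B hB' ⟨x, hxV⟩ hx).symm
    · intro f
      obtain ⟨p, hp, hr⟩ := exists_pair f
      refine ⟨⟨p, hp⟩, ?_⟩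
      funext x
      obtain ⟨B, hB, hx⟩ := (hp.mem x).1 x.2
      exact Subtype.ext ((hF ⟨p, hp⟩ B hB x hx).symm.trans (hr B hB x hx))
  rw [Nat.card_eq_of_bijective F hbij, Nat.card_pi]
  simp only [Nat.card_eq_fintype_card, Fintype.card_coe]
  exact Finset.prod_coe_sort V (fun x => (C.filter (fun S => x ∈ S)).card)

/-- Let `C` be an expanding cover of `[m]`.  The number of pairs `(π, φ)`,
where `π` is a partition of `[m]` and `φ` is an injective map from the blocks of `π` to the
members of `C` with `B ⊆ φ B` for every block `B`, equals the product over all `x ∈ [m]` of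
the number of members of `C` containing `x`. -/
theorem count_spanning_trees_eq_prod_indegrees
    (m : ℕ) (hm : 0 < m) (C : Finset (Finset ℕ))
    (hne : ∀ S ∈ C, S.Nonempty)
    (hunion : C.sup id = Finset.Icc 1 m)
    (hexp1 : ∀ x ∈ Finset.Icc 1 (m - C.card + 1),
        (C.filter (fun S => x ∈ S)).card ≤ 1)
    (hexp2 : ∀ i, 1 ≤ i → i ≤ C.card →
        i ≤ (C.filter (fun S => S ⊆ Finset.Icc 1 (m - C.card + 1 + i - 1))).card) :
    Nat.card {p : Σ π : Finset (Finset ℕ),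
        ({B : Finset ℕ // B ∈ π} → {S : Finset ℕ // S ∈ C}) //
      (∀ B ∈ p.1, B.Nonempty) ∧
      (∀ B ∈ p.1, ∀ B' ∈ p.1, B ≠ B' → Disjoint B B') ∧
      p.1.sup id = Finset.Icc 1 m ∧
      Function.Injective p.2 ∧
      (∀ B : {B : Finset ℕ // B ∈ p.1}, (B : Finset ℕ) ⊆ (p.2 B : Finset ℕ))} =
    ∏ x ∈ Finset.Icc 1 m, (C.filter (fun S => x ∈ S)).card := by
  exact card_goodPair (Finset.Icc 1 m) C
end

section
/- Let C be an expanding cover of [m]. Then the following are equivalent: (a) every member of C contains an element that lies in exactly one member of C; (b) for every pair (π, φ), where π is a partition of [m] and φ is an injective map from the blocks of π to the members of C with B ⊆ φ(B) for every block B, the map φ is a bijection onto C (equivalently, |π| = |C|). -/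
/-- Let `C` be an expanding cover of `[m]`.  Then every member of `C`
contains an element lying in exactly one member of `C` (the tree-child condition) if and
only if every embedding of a partition of `[m]` into `C` (an injective `φ` from the blocks
into `C` with `B ⊆ φ B`) is in fact a bijection onto `C`. -/
theorem treechild_iff_every_spanning_tree_is_support_tree
    (m : ℕ) (hm : 0 < m) (C : Finset (Finset ℕ))
    (hne : ∀ S ∈ C, S.Nonempty)
    (hunion : C.sup id = Finset.Icc 1 m)
    (hexp1 : ∀ x ∈ Finset.Icc 1 (m - C.card + 1),
        (C.filter (fun S => x ∈ S)).card ≤ 1)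
    (hexp2 : ∀ i, 1 ≤ i → i ≤ C.card →
        i ≤ (C.filter (fun S => S ⊆ Finset.Icc 1 (m - C.card + 1 + i - 1))).card) :
    (∀ S ∈ C, ∃ x ∈ S, (C.filter (fun T => x ∈ T)).card = 1) ↔
    (∀ (π : Finset (Finset ℕ)) (φ : Finset ℕ → Finset ℕ),
      (∀ B ∈ π, B.Nonempty) →
      (∀ B ∈ π, ∀ B' ∈ π, B ≠ B' → Disjoint B B') →
      π.sup id = Finset.Icc 1 m →
      Set.InjOn φ ↑π →
      (∀ B ∈ π, φ B ∈ C ∧ B ⊆ φ B) →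
      Set.BijOn φ ↑π ↑C) := by
  have hmem : ∀ x, x ∈ Finset.Icc 1 m ↔ ∃ T ∈ C, x ∈ T := by
    intro x
    rw [← hunion]
    simp [Finset.mem_sup]
  constructor
  · intro ha π φ _ _ hπ hinj hφ
    refine ⟨fun B hB => (hφ B hB).1, hinj, ?_⟩
    intro S hS
    obtain ⟨x, hxS, hx⟩ := ha S hS
    have hxm : x ∈ π.sup id := by
      rw [hπ]
      exact (hmem x).2 ⟨S, hS, hxS⟩
    rw [Finset.mem_sup] at hxm
    obtain ⟨B, hB, hxB⟩ := hxm
    refine ⟨B, hB, ?_⟩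
    exact Finset.card_le_one.1 hx.le _
      (Finset.mem_filter.2 ⟨(hφ B hB).1, (hφ B hB).2 hxB⟩) _
      (Finset.mem_filter.2 ⟨hS, hxS⟩)
  · intro hb
    by_contra hcon
    push Not at hcon
    obtain ⟨S, hS, hall⟩ := hcon
    have hex : ∀ x, ∃ T, x ∈ Finset.Icc 1 m → T ∈ C ∧ x ∈ T ∧ T ≠ S := by
      intro x
      by_cases hx : x ∈ Finset.Icc 1 m
      · obtain ⟨T, hT, hxT⟩ := (hmem x).1 hx
        by_cases hTS : T = S
        · subst hTS
          by_contra hno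
          push Not at hno
          apply hall x hxT
          rw [Finset.card_eq_one]
          refine ⟨T, ?_⟩
          ext U
          simp only [Finset.mem_filter, Finset.mem_singleton]
          constructor
          · rintro ⟨hU, hxU⟩
            exact (hno U).2 hU hxU
          · rintro rfl
            exact ⟨hT, hxT⟩
        · exact ⟨T, fun _ => ⟨hT, hxT, hTS⟩⟩
      · exact ⟨∅, fun h => absurd h hx⟩
    choose f hf using hex
    let g : Finset ℕ → Finset ℕ := fun T => (Finset.Icc 1 m).filter (fun x => f x = T)
    have hg : ∀ T x, x ∈ g T ↔ x ∈ Finset.Icc 1 m ∧ f x = T := by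
      intro T x
      exact Finset.mem_filter
    let φ : Finset ℕ → Finset ℕ := fun B => if h : B.Nonempty then f h.choose else ∅
    have hφg : ∀ y ∈ Finset.Icc 1 m, φ (g (f y)) = f y := by
      intro y hy
      have hn : (g (f y)).Nonempty := ⟨y, (hg _ _).2 ⟨hy, rfl⟩⟩
      have h2 := ((hg _ _).1 hn.choose_spec).2
      simp only [φ, dif_pos hn]
      exact h2
    let π : Finset (Finset ℕ) := (Finset.Icc 1 m).image (fun y => g (f y))
    have hπ : ∀ B ∈ π, ∃ y ∈ Finset.Icc 1 m, g (f y) = B := by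
      intro B hB
      exact Finset.mem_image.1 hB
    have hbij : Set.BijOn φ ↑π ↑C := by
      apply hb π φ
      · intro B hB
        obtain ⟨y, hy, rfl⟩ := hπ B hB
        exact ⟨y, (hg _ _).2 ⟨hy, rfl⟩⟩
      · intro B hB B' hB' hne'
        obtain ⟨y, hy, rfl⟩ := hπ B hB
        obtain ⟨z, hz, rfl⟩ := hπ B' hB'
        rw [Finset.disjoint_left]
        intro x hx hx'
        apply hne'
        rw [← ((hg _ _).1 hx).2, ← ((hg _ _).1 hx').2]
      · ext x
        rw [Finset.mem_sup]
        constructor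
        · rintro ⟨B, hB, hxB⟩
          obtain ⟨y, hy, rfl⟩ := hπ B hB
          exact ((hg _ _).1 hxB).1
        · intro hx
          exact ⟨g (f x), Finset.mem_image.2 ⟨x, hx, rfl⟩, (hg _ _).2 ⟨hx, rfl⟩⟩
      · intro B hB B' hB' heq
        obtain ⟨y, hy, rfl⟩ := hπ B hB
        obtain ⟨z, hz, rfl⟩ := hπ B' hB'
        rw [hφg y hy, hφg z hz] at heq
        rw [heq]
      · intro B hB
        obtain ⟨y, hy, rfl⟩ := hπ B hB
        rw [hφg y hy]
        refine ⟨(hf y hy).1, ?_⟩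
        intro x hx
        obtain ⟨h1, h2⟩ := (hg _ _).1 hx
        rw [← h2]
        exact (hf x h1).2.1
    obtain ⟨B, hB, hBS⟩ := hbij.surjOn hS
    obtain ⟨y, hy, rfl⟩ := hπ B hB
    rw [hφg y hy] at hBS
    exact (hf y hy).2.2 hBS
end

section
/- Let G be a finite directed acyclic graph with exactly one vertex of in-degree 0 (the root), in which every vertex of out-degree 0 (leaf) has in-degree 1, and in which the map sending each vertex of positive out-degree to its set of out-neighbours is injective (G is labellable). Let C be the set of out-neighbour sets of the vertices of positive out-degree. Then every vertex of positive out-degree has an out-neighbour of in-degree 1 (G is tree-child) if and only if every member of C contains a vertex that lies in exactly one member of C. -/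
/-- Let `G` be a finite labellable DAG (edge relation `E`) with a unique
root `ρ` of in-degree 0, in which every leaf (vertex of out-degree 0) has in-degree 1, and
let `C` be the set of out-neighbour sets of the vertices of positive out-degree.  Then `G`
is tree-child (every vertex of positive out-degree has an out-neighbour of in-degree 1) if
and only if every member of `C` contains a vertex lying in exactly one member of `C`. -/
theorem treechild_iff_cover_condition
    {V : Type*} [Finite V] (E : V → V → Prop) (ρ : V)
    (hacyclic : ∀ v, ¬ Relation.TransGen E v v)
    (hroot : ∀ u, ¬ E u ρ)
    (hroot_unique : ∀ v, (∀ u, ¬ E u v) → v = ρ)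
    (hleaf : ∀ v, (∀ w, ¬ E v w) → ∃! u, E u v)
    (hlab : ∀ u v, (∃ w, E u w) → (∃ w, E v w) →
      {w | E u w} = {w | E v w} → u = v) :
    (∀ v, (∃ w, E v w) → ∃ w, E v w ∧ (∃! u, E u w)) ↔
    (∀ S ∈ {S : Set V | ∃ v, (∃ w, E v w) ∧ S = {w | E v w}},
      ∃ x ∈ S, ∃! T, T ∈ {S : Set V | ∃ v, (∃ w, E v w) ∧ S = {w | E v w}} ∧ x ∈ T) := by
  constructor
  · rintro h S ⟨v, hv, rfl⟩
    obtain ⟨w, hw, u, hu, huniq⟩ := h v hv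
    refine ⟨w, hw, {x | E v x}, ⟨⟨v, hv, rfl⟩, hw⟩, ?_⟩
    rintro T ⟨⟨t, ht, rfl⟩, hwt⟩
    have h1 : t = u := huniq t hwt
    have h2 : v = u := huniq v hw
    rw [h1, h2]
  · intro h v hv
    obtain ⟨x, hx, T, hT, huniq⟩ := h {w | E v w} ⟨v, hv, rfl⟩
    refine ⟨x, hx, v, hx, ?_⟩
    intro u hu
    have h1 : {w | E u w} = T := huniq _ ⟨⟨u, ⟨x, hu⟩, rfl⟩, hu⟩
    have h2 : {w | E v w} = T := huniq _ ⟨⟨v, hv, rfl⟩, hx⟩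
    exact hlab u v ⟨x, hu⟩ hv (h1.trans h2.symm)
end

section
/- Let G be a finite directed acyclic graph with exactly one vertex of in-degree 0 (the root), in which every vertex of out-degree 0 (leaf) has in-degree 1, and in which the map sending each vertex of positive out-degree to its set of out-neighbours is injective (G is labellable). Let C be the set of out-neighbour sets of the vertices of positive out-degree. Then every vertex of in-degree at least 2 shares an in-neighbour with some vertex of in-degree 1 (G is tree-sibling) if and only if every vertex lying in more than one member of C lies in at least one member of C that also contains a vertex lying in exactly one member of C. -/
/-- Let `G` be a finite labellable DAG (edge relation `E`) with a unique
root `ρ` of in-degree 0, in which every leaf (vertex of out-degree 0) has in-degree 1, and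
let `C` be the set of out-neighbour sets of the vertices of positive out-degree.  Then `G`
is tree-sibling (every vertex of in-degree at least 2 shares an in-neighbour with some
vertex of in-degree 1) if and only if every vertex lying in more than one member of `C`
lies in at least one member of `C` that also contains a vertex lying in exactly one member
of `C`. -/
theorem treesibling_iff_cover_condition
    {V : Type*} [Finite V] (E : V → V → Prop) (ρ : V)
    (hacyclic : ∀ v, ¬ Relation.TransGen E v v)
    (hroot : ∀ u, ¬ E u ρ)
    (hroot_unique : ∀ v, (∀ u, ¬ E u v) → v = ρ)
    (hleaf : ∀ v, (∀ w, ¬ E v w) → ∃! u, E u v)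
    (hlab : ∀ u v, (∃ w, E u w) → (∃ w, E v w) →
      {w | E u w} = {w | E v w} → u = v) :
    (∀ v, (∃ u u', u ≠ u' ∧ E u v ∧ E u' v) →
      ∃ u w, E u v ∧ E u w ∧ (∃! z, E z w)) ↔
    (∀ x : V,
      (∃ S T, S ∈ {S : Set V | ∃ v, (∃ w, E v w) ∧ S = {w | E v w}} ∧
              T ∈ {S : Set V | ∃ v, (∃ w, E v w) ∧ S = {w | E v w}} ∧
              S ≠ T ∧ x ∈ S ∧ x ∈ T) →
      ∃ S ∈ {S : Set V | ∃ v, (∃ w, E v w) ∧ S = {w | E v w}},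
        x ∈ S ∧ ∃ y ∈ S,
          ∃! T, T ∈ {S : Set V | ∃ v, (∃ w, E v w) ∧ S = {w | E v w}} ∧ y ∈ T) := by
  constructor
  · rintro h x ⟨_, _, ⟨u, -, rfl⟩, ⟨u', -, rfl⟩, hne, hx, hx'⟩
    obtain ⟨a, w, hav, haw, z, hz, hzu⟩ := h x ⟨u, u', fun e => hne (by rw [e]), hx, hx'⟩
    refine ⟨{w | E a w}, ⟨a, ⟨w, haw⟩, rfl⟩, hav, w, haw, {w | E z w}, ⟨⟨z, ⟨w, hz⟩, rfl⟩, hz⟩, ?_⟩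
    rintro _ ⟨⟨b, -, rfl⟩, hb⟩
    rw [hzu b hb]
  · rintro h v ⟨u, u', hne, hu, hu'⟩
    obtain ⟨_, ⟨a, -, rfl⟩, hav, y, hay, T, -, hT⟩ := h v
      ⟨{w | E u w}, {w | E u' w}, ⟨u, ⟨v, hu⟩, rfl⟩, ⟨u', ⟨v, hu'⟩, rfl⟩,
        fun e => hne (hlab u u' ⟨v, hu⟩ ⟨v, hu'⟩ e), hu, hu'⟩
    refine ⟨a, y, hav, hay, a, hay, fun b hb => hlab b a ⟨y, hb⟩ ⟨y, hay⟩ ?_⟩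
    rw [hT {w | E b w} ⟨⟨b, ⟨y, hb⟩, rfl⟩, hb⟩, hT {w | E a w} ⟨⟨a, ⟨y, hay⟩, rfl⟩, hay⟩]
end

section
/- Let C be a cover of [m] such that every member of C contains an element that lies in exactly one member of C. Then there exist a partition π of [m] and a bijection φ from the blocks of π to the members of C with B ⊆ φ(B) for every block B; that is, C has a fully embedded partition (the associated tree-child network is tree-based). -/
/-- Let `C` be a cover of `[m]` such that every member of `C` contains an
element lying in exactly one member of `C` (the tree-child condition).  Then `C` has a
fully embedded partition: there are a partition `π` of `[m]` and a bijection `φ` from the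
blocks of `π` to the members of `C` with `B ⊆ φ B` for every block `B`. -/
theorem treechild_cover_has_fully_embedded_partition
    (m : ℕ) (hm : 0 < m) (C : Finset (Finset ℕ))
    (hne : ∀ S ∈ C, S.Nonempty)
    (hunion : C.sup id = Finset.Icc 1 m)
    (htc : ∀ S ∈ C, ∃ x ∈ S, (C.filter (fun T => x ∈ T)).card = 1) :
    ∃ (π : Finset (Finset ℕ)) (φ : Finset ℕ → Finset ℕ),
      (∀ B ∈ π, B.Nonempty) ∧
      (∀ B ∈ π, ∀ B' ∈ π, B ≠ B' → Disjoint B B') ∧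
      π.sup id = Finset.Icc 1 m ∧
      Set.BijOn φ ↑π ↑C ∧
      (∀ B ∈ π, B ⊆ φ B) := by
  classical
  have hf : ∀ x, ∃ T, x ∈ Finset.Icc 1 m → T ∈ C ∧ x ∈ T := by
    intro x
    by_cases hx : x ∈ Finset.Icc 1 m
    · rw [← hunion, Finset.mem_sup] at hx
      obtain ⟨T, hT, hxT⟩ := hx
      exact ⟨T, fun _ => ⟨hT, hxT⟩⟩
    · exact ⟨∅, fun h => absurd h hx⟩
  choose f hf using hf
  have hsub : ∀ S ∈ C, ∀ x ∈ S, x ∈ Finset.Icc 1 m := by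
    intro S hS x hx
    rw [← hunion, Finset.mem_sup]
    exact ⟨S, hS, hx⟩
  let g : Finset ℕ → Finset ℕ := fun S => S.filter (fun x => f x = S)
  have hg : ∀ S x, x ∈ g S ↔ x ∈ S ∧ f x = S := fun S x => Finset.mem_filter
  have gne : ∀ S ∈ C, (g S).Nonempty := by
    intro S hS
    obtain ⟨x, hxS, hc⟩ := htc S hS
    obtain ⟨hfC, hxf⟩ := hf x (hsub S hS x hxS)
    refine ⟨x, (hg S x).2 ⟨hxS, ?_⟩⟩
    exact Finset.card_le_one.1 hc.le _ (Finset.mem_filter.2 ⟨hfC, hxf⟩) _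
      (Finset.mem_filter.2 ⟨hS, hxS⟩)
  have ginj : Set.InjOn g (C : Set (Finset ℕ)) := by
    intro S hS T hT h
    obtain ⟨x, hx⟩ := gne S hS
    have hx2 := hx
    rw [h] at hx2
    exact ((hg S x).1 hx).2.symm.trans ((hg T x).1 hx2).2
  have hinv : ∀ S ∈ C, Function.invFunOn g (C : Set (Finset ℕ)) (g S) = S :=
    fun S hS => ginj.leftInvOn_invFunOn hS
  refine ⟨C.image g, Function.invFunOn g (C : Set (Finset ℕ)), ?_, ?_, ?_, ⟨?_, ?_, ?_⟩, ?_⟩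
  · intro B hB
    obtain ⟨S, hS, rfl⟩ := Finset.mem_image.1 hB
    exact gne S hS
  · intro B hB B' hB' hne'
    obtain ⟨S, hS, rfl⟩ := Finset.mem_image.1 hB
    obtain ⟨T, hT, rfl⟩ := Finset.mem_image.1 hB'
    rw [Finset.disjoint_left]
    intro x hx hx2
    apply hne'
    rw [← ((hg S x).1 hx).2, ← ((hg T x).1 hx2).2]
  · ext x
    rw [Finset.mem_sup]
    constructor
    · rintro ⟨B, hB, hx⟩
      obtain ⟨S, hS, rfl⟩ := Finset.mem_image.1 hB
      exact hsub S hS x ((hg S x).1 hx).1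
    · intro hx
      obtain ⟨h1, h2⟩ := hf x hx
      exact ⟨g (f x), Finset.mem_image_of_mem g h1, (hg _ _).2 ⟨h2, rfl⟩⟩
  · intro B hB
    obtain ⟨S, hS, rfl⟩ := Finset.mem_image.1 (Finset.mem_coe.1 hB)
    rw [hinv S hS]
    exact hS
  · intro B hB B' hB' h
    obtain ⟨S, hS, rfl⟩ := Finset.mem_image.1 (Finset.mem_coe.1 hB)
    obtain ⟨T, hT, rfl⟩ := Finset.mem_image.1 (Finset.mem_coe.1 hB')
    rw [hinv S hS, hinv T hT] at h
    rw [h]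
  · intro S hS
    exact ⟨g S, Finset.mem_coe.2 (Finset.mem_image_of_mem g hS), hinv S hS⟩
  · intro B hB
    obtain ⟨S, hS, rfl⟩ := Finset.mem_image.1 hB
    rw [hinv S hS]
    exact Finset.filter_subset _ _
end
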